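/- Let N ≥ 3, let B be the open unit ball in ℝ^N, and let λ ∈ ℝ be arbitrary. Then there is no function u that is continuously differentiable on the closed unit ball and twice continuously differentiable on B, with u > 0 in B and u = 0 on the unit sphere, satisfying −Δu(x) = u(x)^((N+2)/(N−2)) + λ·u(x)^((N+2)/(N−2)) = (1+λ)·u(x)^((N+2)/(N−2)) for all x ∈ B. -/

import Mathlib

open scoped NNReal
open MeasureTheory Filter Set Metric

noncomputable def laplacian {N : ℕ} (u : EuclideanSpace ℝ (Fin N) → ℝ)
    (x : EuclideanSpace ℝ (Fin N)) : ℝ :=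
  ∑ i, fderiv ℝ (fun y => fderiv ℝ u y (EuclideanSpace.single i (1:ℝ))) x
      (EuclideanSpace.single i (1:ℝ))


lemma aux_integrable {N : ℕ} (f ψ : EuclideanSpace ℝ (Fin N) → ℝ) (r : ℝ) (hr : r < 1)
    (hf : ContinuousOn f (ball 0 1)) (hψ : Continuous ψ) (hs : ∀ x, r < ‖x‖ → ψ x = 0) :
    Integrable (fun x => f x * ψ x) := by
  have h1 : IntegrableOn (fun x => f x * ψ x) (closedBall 0 r) := by
    apply ContinuousOn.integrableOn_compact (isCompact_closedBall 0 r)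
    exact (hf.mono (closedBall_subset_ball hr)).mul hψ.continuousOn
  rwa [integrableOn_iff_integrable_of_support_subset] at h1
  intro x hx
  by_contra h
  apply hx
  simp only [mem_closedBall, dist_zero_right, not_le] at h
  simp [hs x h]

lemma aux_st_deriv_zero (t : ℝ) (h : t < 0 ∨ 1 < t) : deriv Real.smoothTransition t = 0 := by
  rcases h with h | h
  · have : Real.smoothTransition =ᶠ[nhds t] fun _ => (0:ℝ) := by
      filter_upwards [Iio_mem_nhds h] with s hs
      exact Real.smoothTransition.zero_of_nonpos (le_of_lt hs)
    rw [this.deriv_eq]; simp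
  · have : Real.smoothTransition =ᶠ[nhds t] fun _ => (1:ℝ) := by
      filter_upwards [Ioi_mem_nhds h] with s hs
      exact Real.smoothTransition.one_of_one_le (le_of_lt hs)
    rw [this.deriv_eq]; simp

lemma aux_cutoff {N : ℕ} (r0 : ℝ) (h0 : 1/2 ≤ r0) (h1 : r0 < 1) :
    ∃ (φ c : EuclideanSpace ℝ (Fin N) → ℝ) (r : ℝ), r < 1 ∧ ContDiff ℝ 1 φ ∧
      (∀ x, 0 ≤ φ x) ∧ (∀ x, φ x ≤ 1) ∧ (∀ x, ‖x‖ ≤ 1/2 → φ x = 1) ∧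
      (∀ x, r < ‖x‖ → φ x = 0) ∧ (∀ x, 0 ≤ c x) ∧ (∀ x, ‖x‖ ≤ r0 → c x = 0) ∧
      (∀ x, r < ‖x‖ → c x = 0) ∧
      (∀ x i, fderiv ℝ φ x (EuclideanSpace.single i (1:ℝ)) = - (c x * x i)) := by
  obtain ⟨r1, h01, h11⟩ := exists_between h1
  obtain ⟨r, h1r, hr⟩ := exists_between h11
  have hd : 0 < r^2 - r1^2 := by nlinarith
  have hst : ContDiff ℝ 1 Real.smoothTransition := Real.smoothTransition.contDiff (n := 1)
  refine ⟨fun x => Real.smoothTransition ((r^2 - ‖x‖^2) / (r^2 - r1^2)),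
    fun x => 2 / (r^2 - r1^2) * deriv Real.smoothTransition ((r^2 - ‖x‖^2) / (r^2 - r1^2)), r, hr,
    ?_, fun x => Real.smoothTransition.nonneg _, fun x => Real.smoothTransition.le_one _, ?_, ?_,
    ?_, ?_, ?_, ?_⟩
  · apply hst.comp
    exact (contDiff_const.sub (contDiff_norm_sq ℝ)).div_const _
  · intro x hx
    apply Real.smoothTransition.one_of_one_le
    rw [le_div_iff₀ hd]
    nlinarith [norm_nonneg x]
  · intro x hx
    apply Real.smoothTransition.zero_of_nonpos
    apply div_nonpos_of_nonpos_of_nonneg _ hd.le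
    nlinarith [norm_nonneg x]
  · intro x
    have := Real.smoothTransition.monotone.deriv_nonneg (x := (r^2 - ‖x‖^2) / (r^2 - r1^2))
    positivity
  · intro x hx
    beta_reduce
    rw [aux_st_deriv_zero, mul_zero]
    right
    rw [lt_div_iff₀ hd]
    nlinarith [norm_nonneg x]
  · intro x hx
    beta_reduce
    rw [aux_st_deriv_zero, mul_zero]
    left
    apply div_neg_of_neg_of_pos _ hd
    nlinarith [norm_nonneg x]
  · intro x i
    have e1 : HasFDerivAt (fun x : EuclideanSpace ℝ (Fin N) => (r^2 - ‖x‖^2) / (r^2 - r1^2))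
        ((r^2 - r1^2)⁻¹ • (-(2 • (innerSL ℝ x)) : EuclideanSpace ℝ (Fin N) →L[ℝ] ℝ)) x := by
      have := (((hasStrictFDerivAt_norm_sq x).hasFDerivAt).const_sub (r^2)).const_smul
        ((r^2 - r1^2)⁻¹)
      have e0 : (fun x : EuclideanSpace ℝ (Fin N) => (r^2 - ‖x‖^2) / (r^2 - r1^2))
          = (r^2 - r1^2)⁻¹ • fun x : EuclideanSpace ℝ (Fin N) => r^2 - ‖x‖^2 := by
        funext y
        simp only [Pi.smul_apply, smul_eq_mul, div_eq_inv_mul]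
      rw [e0]
      exact this
    have e2 := ((hst.differentiable (by norm_num)).differentiableAt
      (x := (r^2 - ‖x‖^2) / (r^2 - r1^2))).hasDerivAt.comp_hasFDerivAt x e1
    have e3 := e2.fderiv
    simp only [Function.comp_def] at e3
    rw [e3]
    simp [EuclideanSpace.inner_single_right]
    ring

lemma aux_div {N : ℕ} (W : Fin N → EuclideanSpace ℝ (Fin N) → ℝ)
    (hW : ∀ i, ContDiffOn ℝ 1 (W i) (ball 0 1)) (r0 : ℝ) (h1 : r0 < 1)
    (hb : ∀ x : EuclideanSpace ℝ (Fin N), r0 < ‖x‖ → ‖x‖ < 1 → 0 ≤ ∑ i, x i * W i x) :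
    ∃ (φ : EuclideanSpace ℝ (Fin N) → ℝ) (r : ℝ), r < 1 ∧ Continuous φ ∧
      (∀ x, 0 ≤ φ x) ∧ (∀ x, φ x ≤ 1) ∧ (∀ x, ‖x‖ ≤ 1/2 → φ x = 1) ∧
      (∀ x, r < ‖x‖ → φ x = 0) ∧
      0 ≤ ∫ x, (∑ i, fderiv ℝ (W i) x (EuclideanSpace.single i (1:ℝ))) * φ x := by
  obtain ⟨φ, c, r, hr, hφ, p0, p1, ph, pr, c0, cr0, cr, hd⟩ :=
    aux_cutoff (N := N) (max r0 (1/2)) (le_max_right _ _) (max_lt h1 (by norm_num))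
  refine ⟨φ, r, hr, hφ.continuous, p0, p1, ph, pr, ?_⟩
  have hts : tsupport φ ⊆ closedBall 0 r := by
    apply closure_minimal _ isClosed_closedBall
    intro x hx
    by_contra h
    simp only [mem_closedBall, dist_zero_right, not_le] at h
    exact hx (pr x h)
  have I1 : ∀ i, Integrable (fun x => fderiv ℝ (W i) x (EuclideanSpace.single i (1:ℝ)) * φ x) := by
    intro i
    refine aux_integrable _ _ r hr ?_ hφ.continuous pr
    exact ((hW i).continuousOn_fderiv_of_isOpen isOpen_ball le_rfl).clm_apply continuousOn_const
  have I2 : ∀ i, Integrable (fun x => W i x * fderiv ℝ φ x (EuclideanSpace.single i (1:ℝ))) := by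
    intro i
    refine aux_integrable _ _ r hr (hW i).continuousOn ?_ ?_
    · exact (hφ.continuous_fderiv (by norm_num)).clm_apply continuous_const
    · intro x hx; rw [hd, cr x hx]; simp
  have I3 : ∀ i, Integrable (fun x => W i x * φ x) := fun i =>
    aux_integrable _ _ r hr (hW i).continuousOn hφ.continuous pr
  have key : ∀ i, ∫ x, fderiv ℝ (W i) x (EuclideanSpace.single i (1:ℝ)) * φ x
      = - ∫ x, W i x * fderiv ℝ φ x (EuclideanSpace.single i (1:ℝ)) := by
    intro i
    rw [integral_mul_fderiv_eq_neg_fderiv_mul_of_integrable (I1 i) (I2 i) (I3 i), neg_neg]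
    · intro x hx
      exact ((hW i).differentiableOn (by norm_num)).differentiableAt
        (isOpen_ball.mem_nhds (closedBall_subset_ball hr (hts hx)))
    · intro x _
      exact (hφ.differentiable (by norm_num)).differentiableAt
  simp_rw [Finset.sum_mul]
  rw [integral_finsetSum _ (fun i _ => I1 i)]
  simp_rw [key, ← integral_neg]
  rw [← integral_finsetSum _ (fun i _ => (I2 i).fun_neg)]
  apply integral_nonneg
  intro x
  have : ∑ i, -(W i x * fderiv ℝ φ x (EuclideanSpace.single i (1:ℝ)))
      = c x * ∑ i, x i * W i x := by
    rw [Finset.mul_sum]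
    refine Finset.sum_congr rfl fun i _ => ?_
    rw [hd]; ring
  simp only [Pi.zero_apply]
  rw [this]
  by_cases h : ‖x‖ ≤ max r0 (1/2)
  · rw [cr0 x h]; simp
  · by_cases h' : r < ‖x‖
    · rw [cr x h']; simp
    · exact mul_nonneg (c0 x) (hb x ((le_max_left _ _).trans_lt (not_le.1 h)) (by linarith))

lemma aux_near {N : ℕ} (G : EuclideanSpace ℝ (Fin N) → ℝ)
    (hG : ContinuousOn G (closedBall 0 1)) (hp : ∀ x, ‖x‖ = 1 → 0 < G x) :
    ∃ r0 < 1, ∀ x, r0 < ‖x‖ → ‖x‖ < 1 → 0 ≤ G x := by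
  have hK : IsCompact (closedBall (0:EuclideanSpace ℝ (Fin N)) 1 ∩ G ⁻¹' Iic 0) :=
    (isCompact_closedBall _ _).of_isClosed_subset
      (hG.preimage_isClosed_of_isClosed isClosed_closedBall isClosed_Iic) inter_subset_left
  rcases Set.eq_empty_or_nonempty (closedBall (0:EuclideanSpace ℝ (Fin N)) 1 ∩ G ⁻¹' Iic 0)
    with h | h
  · refine ⟨0, by norm_num, fun x _ hx => ?_⟩
    by_contra hc
    have : x ∈ (closedBall (0:EuclideanSpace ℝ (Fin N)) 1 ∩ G ⁻¹' Iic 0) :=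
      ⟨by simpa using hx.le, le_of_lt (not_le.1 hc)⟩
    rw [h] at this; exact this
  · obtain ⟨y, hy, hm⟩ := hK.exists_isMaxOn h continuous_norm.continuousOn
    refine ⟨‖y‖, ?_, fun x hx hx1 => ?_⟩
    · have h1 : ‖y‖ ≤ 1 := by simpa using hy.1
      refine lt_of_le_of_ne h1 fun he => ?_
      exact absurd (hp y he) (not_lt.2 hy.2)
    · by_contra hc
      have := hm (show x ∈ (closedBall (0:EuclideanSpace ℝ (Fin N)) 1 ∩ G ⁻¹' Iic 0) from
        ⟨by simpa using hx1.le, le_of_lt (not_le.1 hc)⟩)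
      simp only [mem_ofPred_eq] at this
      linarith

lemma aux_main {N : ℕ} (g : EuclideanSpace ℝ (Fin N) → ℝ)
    (hg : ContinuousOn g (ball 0 1)) (gpos : ∀ x ∈ ball (0:EuclideanSpace ℝ (Fin N)) 1, 0 < g x)
    (H : ∀ ε > 0, ∃ (V : Fin N → EuclideanSpace ℝ (Fin N) → ℝ) (F : EuclideanSpace ℝ (Fin N) → ℝ),
      (∀ i, ContDiffOn ℝ 1 (V i) (ball 0 1)) ∧ ContinuousOn F (closedBall 0 1) ∧
      (∀ x ∈ ball (0:EuclideanSpace ℝ (Fin N)) 1, F x = ∑ i, x i * V i x) ∧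
      (∀ x ∈ sphere (0:EuclideanSpace ℝ (Fin N)) 1, -ε < F x) ∧
      (∀ x ∈ ball (0:EuclideanSpace ℝ (Fin N)) 1,
        ∑ i, fderiv ℝ (V i) x (EuclideanSpace.single i (1:ℝ)) = - g x)) : False := by
  set m := ∫ x in closedBall (0:EuclideanSpace ℝ (Fin N)) (1/2), g x with hm
  have hsub : closedBall (0:EuclideanSpace ℝ (Fin N)) (1/2) ⊆ ball 0 1 :=
    closedBall_subset_ball (by norm_num)
  have hgi : IntegrableOn g (closedBall (0:EuclideanSpace ℝ (Fin N)) (1/2)) :=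
    (hg.mono hsub).integrableOn_compact (isCompact_closedBall _ _)
  have mpos : 0 < m := by
    rw [hm, setIntegral_pos_iff_support_of_nonneg_ae _ hgi]
    · have : closedBall (0:EuclideanSpace ℝ (Fin N)) (1/2) ⊆
          Function.support g ∩ closedBall (0:EuclideanSpace ℝ (Fin N)) (1/2) :=
        fun x hx => ⟨(gpos x (hsub hx)).ne', hx⟩
      exact lt_of_lt_of_le (measure_closedBall_pos _ _ (by norm_num)) (measure_mono this)
    · filter_upwards [ae_restrict_mem measurableSet_closedBall] with x hx
      exact (gpos x (hsub hx)).le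
  set vol := (volume : Measure (EuclideanSpace ℝ (Fin N))).real (ball 0 1) with hvol
  have volnn : 0 ≤ vol := measureReal_nonneg
  set ε := m / (2 * (N * vol + 1)) with hε
  have epos : 0 < ε := by positivity
  obtain ⟨V, F, hV, hF, hFV, hFs, hdiv⟩ := H ε epos
  obtain ⟨r0, hr0, hr0'⟩ := aux_near (fun x => F x + ε * ‖x‖^2)
    (hF.add (by fun_prop)) (fun x hx => by
      have := hFs x (by simpa using hx)
      simp only [hx]; linarith)
  have hco : ∀ i : Fin N, ContDiff ℝ 1 (fun x : EuclideanSpace ℝ (Fin N) => ε * x i) := by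
    intro i; fun_prop
  obtain ⟨φ, r, hr, hφ, p0, p1, ph, pr, hint⟩ := aux_div (fun i x => V i x + ε * x i)
    (fun i => (hV i).add (hco i).contDiffOn) r0 hr0 (by
      intro x hx hx1
      have := hr0' x hx hx1
      rw [hFV x (by simpa using hx1), EuclideanSpace.real_norm_sq_eq, Finset.mul_sum,
        ← Finset.sum_add_distrib] at this
      refine this.trans_eq (Finset.sum_congr rfl fun i _ => ?_)
      ring)
  have e1 : ∀ x, (∑ i, fderiv ℝ (fun x => V i x + ε * x i) x (EuclideanSpace.single i (1:ℝ)))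
      * φ x = (N * ε) * φ x - g x * φ x := by
    intro x
    by_cases hx : ‖x‖ < 1
    · have hxb : x ∈ ball (0:EuclideanSpace ℝ (Fin N)) 1 := by simpa using hx
      have : ∀ i, fderiv ℝ (fun x => V i x + ε * x i) x (EuclideanSpace.single i (1:ℝ))
          = fderiv ℝ (V i) x (EuclideanSpace.single i (1:ℝ)) + ε := by
        intro i
        have h1 : HasFDerivAt (V i) (fderiv ℝ (V i) x) x :=
          (((hV i).differentiableOn (by norm_num)).differentiableAt
            (isOpen_ball.mem_nhds hxb)).hasFDerivAt
        have h2 : HasFDerivAt (fun x : EuclideanSpace ℝ (Fin N) => x i)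
            (EuclideanSpace.proj (𝕜 := ℝ) i : EuclideanSpace ℝ (Fin N) →L[ℝ] ℝ) x :=
          (EuclideanSpace.proj (𝕜 := ℝ) i : EuclideanSpace ℝ (Fin N) →L[ℝ] ℝ).hasFDerivAt
        rw [(h1.fun_add (h2.const_mul ε)).fderiv]
        simp
      simp_rw [this]
      rw [Finset.sum_add_distrib, hdiv x hxb]
      simp
      ring
    · rw [pr x (by linarith)]; simp
  simp_rw [e1] at hint
  have J0 : Integrable φ := by
    simpa using aux_integrable (fun _ => 1) φ r hr continuousOn_const hφ pr
  have J1 : Integrable (fun x => g x * φ x) := aux_integrable g φ r hr hg hφ pr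
  rw [integral_sub (J0.const_mul _) J1, integral_const_mul] at hint
  have b1 : ∫ x, φ x ≤ vol := by
    have : ∫ x in ball 0 1, φ x = ∫ x, φ x := by
      apply setIntegral_eq_integral_of_forall_compl_eq_zero
      intro x hx
      apply pr
      simp at hx; linarith
    rw [← this]
    calc ∫ x in ball 0 1, φ x ≤ ∫ x in ball (0:EuclideanSpace ℝ (Fin N)) 1, (1:ℝ) := by
          apply integral_mono J0.integrableOn
          · exact integrableOn_const (measure_ball_lt_top).ne
          · exact p1
      _ = vol := by simp [hvol]
  have b2 : m ≤ ∫ x, g x * φ x := by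
    have : m = ∫ x in closedBall 0 (1/2), g x * φ x := by
      apply setIntegral_congr_fun measurableSet_closedBall
      intro x hx
      simp only
      rw [ph x (by simpa using hx), mul_one]
    rw [this]
    apply setIntegral_le_integral J1
    refine Eventually.of_forall fun x => ?_
    by_cases hx : ‖x‖ < 1
    · exact mul_nonneg (gpos x (by simpa using hx)).le (p0 x)
    · simp [pr x (by linarith)]
  have b3 : N * ε * ∫ x, φ x ≤ N * ε * vol := by gcongr
  have b4 : ε * (2 * (N * vol + 1)) = m := by rw [hε]; field_simp
  nlinarith

lemma aux_tang {N : ℕ} (u : EuclideanSpace ℝ (Fin N) → ℝ) (L : EuclideanSpace ℝ (Fin N) →L[ℝ] ℝ)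
    (x w : EuclideanSpace ℝ (Fin N)) (hx : ‖x‖ = 1) (hxw : inner ℝ x w = 0)
    (hL : HasFDerivWithinAt u L (closedBall 0 1) x)
    (hu : ∀ x ∈ sphere (0 : EuclideanSpace ℝ (Fin N)) 1, u x = 0) : L w = 0 := by
  have main : ∀ w : EuclideanSpace ℝ (Fin N), inner ℝ x w = 0 → ‖w‖ = 1 → L w = 0 := by
    intro w hxw hw
    have hn : ∀ t : ℝ, ‖Real.cos t • x + Real.sin t • w‖ = 1 := by
      intro t
      have : ‖Real.cos t • x + Real.sin t • w‖^2 = 1 := by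
        rw [norm_add_sq_real, norm_smul, norm_smul, inner_smul_left, inner_smul_right, hxw, hx, hw]
        simp
      nlinarith [norm_nonneg (Real.cos t • x + Real.sin t • w)]
    have hγ : HasDerivAt (fun t : ℝ => Real.cos t • x + Real.sin t • w) w 0 := by
      have := ((Real.hasDerivAt_cos 0).smul_const x).fun_add ((Real.hasDerivAt_sin 0).smul_const w)
      simpa using this
    have hL' : HasFDerivWithinAt u L (closedBall 0 1)
        ((fun t : ℝ => Real.cos t • x + Real.sin t • w) 0) := by simpa using hL
    have h1 := hL'.comp_hasDerivWithinAt (s := univ) 0 hγ.hasDerivWithinAt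
      (fun t _ => by simpa using (hn t).le)
    rw [hasDerivWithinAt_univ] at h1
    have h2 : (u ∘ fun t : ℝ => Real.cos t • x + Real.sin t • w) = fun _ => (0:ℝ) := by
      funext t
      exact hu _ (by simpa using hn t)
    rw [h2] at h1
    exact h1.unique (hasDerivAt_const _ _)
  by_cases h : w = 0
  · simp [h]
  · have hw : ‖w‖ ≠ 0 := by simpa using h
    have := main (‖w‖⁻¹ • w) (by rw [inner_smul_right, hxw, mul_zero])
      (by rw [norm_smul, norm_inv, norm_norm, inv_mul_cancel₀ hw])
    rw [map_smul, smul_eq_mul] at this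
    simpa [hw] using this

theorem stmt_4 (N : ℕ) (hN : 3 ≤ N) (lam : ℝ) :
    ¬ ∃ u : EuclideanSpace ℝ (Fin N) → ℝ,
      ContDiffOn ℝ 1 u (closedBall 0 1) ∧
      ContDiffOn ℝ 2 u (ball 0 1) ∧
      (∀ x ∈ ball (0 : EuclideanSpace ℝ (Fin N)) 1, 0 < u x) ∧
      (∀ x ∈ sphere (0 : EuclideanSpace ℝ (Fin N)) 1, u x = 0) ∧
      (∀ x ∈ ball (0 : EuclideanSpace ℝ (Fin N)) 1,
        -laplacian u x = u x ^ (((N : ℝ) + 2) / ((N : ℝ) - 2))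
          + lam * u x ^ (((N : ℝ) + 2) / ((N : ℝ) - 2))) := by
  rintro ⟨u, hu1, hu2, hpos, hzero, hpde⟩
  have hN' : (3:ℝ) ≤ N := by exact_mod_cast hN
  set p : ℝ := ((N : ℝ) + 2) / ((N : ℝ) - 2) with hp
  set C : ℝ := 1 + lam with hC
  set q : ℝ := p + 1 with hq
  have hN2 : (N:ℝ) - 2 ≠ 0 := by linarith
  have hqv : q * ((N:ℝ) - 2) = 2 * N := by rw [hq, hp]; field_simp; ring
  have ppos : 0 < p := by rw [hp]; apply div_pos <;> linarith
  have qpos : 0 < q := by linarith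
  obtain ⟨d, hd⟩ : ∃ d : Fin N → EuclideanSpace ℝ (Fin N) → ℝ,
    d = fun i y => fderiv ℝ u y (EuclideanSpace.single i (1:ℝ)) := ⟨_, rfl⟩
  obtain ⟨D, hD⟩ : ∃ D : Fin N → EuclideanSpace ℝ (Fin N) → ℝ,
    D = fun i y => fderivWithin ℝ u (closedBall 0 1) y (EuclideanSpace.single i (1:ℝ)) := ⟨_, rfl⟩
  have hdC : ∀ i, ContDiffOn ℝ 1 (d i) (ball 0 1) := by
    intro i
    rw [hd]
    exact (hu2.fderiv_of_isOpen isOpen_ball (by norm_num)).clm_apply contDiffOn_const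
  have hud : UniqueDiffOn ℝ (closedBall (0:EuclideanSpace ℝ (Fin N)) 1) :=
    uniqueDiffOn_convex (convex_closedBall _ _) (by
      rw [interior_closedBall _ one_ne_zero]; exact ⟨0, by simp⟩)
  have hDC : ∀ i, ContinuousOn (D i) (closedBall 0 1) := by
    intro i
    rw [hD]
    exact (hu1.continuousOn_fderivWithin hud le_rfl).clm_apply continuousOn_const
  have hDd : ∀ i, ∀ x ∈ ball (0 : EuclideanSpace ℝ (Fin N)) 1, D i x = d i x := by
    intro i x hx
    rw [hD, hd]
    simp only
    rw [fderivWithin_of_mem_nhds (mem_of_superset (isOpen_ball.mem_nhds hx) ball_subset_closedBall)]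
  have hsum : ∀ x : EuclideanSpace ℝ (Fin N), ‖x‖ = 1 → ∑ i, x i ^ 2 = 1 := by
    intro x hx
    rw [← EuclideanSpace.real_norm_sq_eq, hx]; norm_num
  have hDs : ∀ i, ∀ x : EuclideanSpace ℝ (Fin N), ‖x‖ = 1 → D i x = x i * ∑ j, x j * D j x := by
    intro i x hx
    have hL := ((hu1.differentiableOn (by norm_num)) x (by simp [hx])).hasFDerivWithinAt
    have h1 := aux_tang u _ x (EuclideanSpace.single i (1:ℝ) - x i • x) hx (by
      rw [inner_sub_right, inner_smul_right, real_inner_self_eq_norm_sq, hx]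
      simp [EuclideanSpace.inner_single_right]) hL hzero
    rw [map_sub, map_smul, sub_eq_zero] at h1
    have h2 : x = ∑ j, x j • EuclideanSpace.single j (1:ℝ) := by
      ext k
      simp [Finset.sum_apply, Pi.single_apply]
    have h3 : fderivWithin ℝ u (closedBall 0 1) x x = ∑ j, x j * D j x := by
      conv_lhs => rw [h2]
      rw [map_sum, ← h2, hD]
      simp
    rw [h3] at h1
    rw [hD]; rw [hD] at h1
    simpa using h1
  have hdx : ∀ i, ∀ x ∈ ball (0 : EuclideanSpace ℝ (Fin N)) 1,
      HasFDerivAt (d i) (fderiv ℝ (d i) x) x := fun i x hx =>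
    (((hdC i).differentiableOn (by norm_num)).differentiableAt
      (isOpen_ball.mem_nhds hx)).hasFDerivAt
  have hux : ∀ x ∈ ball (0 : EuclideanSpace ℝ (Fin N)) 1,
      HasFDerivAt u (fderiv ℝ u x) x := fun x hx =>
    ((hu2.differentiableOn (by norm_num)).differentiableAt
      (isOpen_ball.mem_nhds hx)).hasFDerivAt
  have hxx : ∀ (i : Fin N) (x : EuclideanSpace ℝ (Fin N)),
      HasFDerivAt (fun x : EuclideanSpace ℝ (Fin N) => x i)
        (EuclideanSpace.proj (𝕜 := ℝ) i : EuclideanSpace ℝ (Fin N) →L[ℝ] ℝ) x := fun i x =>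
    (EuclideanSpace.proj (𝕜 := ℝ) i : EuclideanSpace ℝ (Fin N) →L[ℝ] ℝ).hasFDerivAt
  have hue : ∀ x i, fderiv ℝ u x (EuclideanSpace.single i (1:ℝ)) = d i x := by
    intro x i; rw [hd]
  obtain ⟨h, hh⟩ : ∃ h : Fin N → Fin N → EuclideanSpace ℝ (Fin N) → ℝ,
    ∀ i j x, fderiv ℝ (d i) x (EuclideanSpace.single j (1:ℝ)) = h i j x := ⟨_, fun _ _ _ => rfl⟩
  have hsymm : ∀ x ∈ ball (0 : EuclideanSpace ℝ (Fin N)) 1, ∀ i j, h i j x = h j i x := by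
    intro x hx i j
    have hc := hu2.contDiffAt (isOpen_ball.mem_nhds hx)
    have hs := (hc.isSymmSndFDerivAt (by simp)).eq
      (EuclideanSpace.single j (1:ℝ)) (EuclideanSpace.single i (1:ℝ))
    have hdiff : DifferentiableAt ℝ (fderiv ℝ u) x :=
      (((hu2.fderiv_of_isOpen (m := 1) isOpen_ball (by norm_num)).differentiableOn
        (by norm_num)).differentiableAt (isOpen_ball.mem_nhds hx))
    have e : ∀ i j, h i j x = fderiv ℝ (fderiv ℝ u) x (EuclideanSpace.single j (1:ℝ))
        (EuclideanSpace.single i (1:ℝ)) := by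
      intro i j
      rw [← hh, hd]
      simp only
      rw [fderiv_clm_apply hdiff (differentiableAt_const _)]
      simp
    rw [e, e, hs]
  have hlap : ∀ x ∈ ball (0 : EuclideanSpace ℝ (Fin N)) 1, ∑ i, h i i x = - (C * u x ^ p) := by
    intro x hx
    have := hpde x hx
    have e : laplacian u x = ∑ i, h i i x := by
      unfold laplacian
      refine Finset.sum_congr rfl fun i _ => ?_
      rw [← hh, hd]
    rw [e] at this
    rw [hC]; linarith
  have hxC : ∀ i : Fin N, ContDiff ℝ 1 (fun x : EuclideanSpace ℝ (Fin N) => x i) := by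
    intro i; fun_prop
  have hxc : ∀ i : Fin N, Continuous (fun x : EuclideanSpace ℝ (Fin N) => x i) := by
    intro i; fun_prop
  have hu1' : ContDiffOn ℝ 1 u (ball 0 1) := hu2.of_le (by norm_num)
  have huc : ContinuousOn u (closedBall 0 1) := hu1.continuousOn
  have hupc : ContinuousOn (fun x => u x ^ p) (ball 0 1) :=
    hu1'.continuousOn.rpow_const fun x hx => Or.inl (hpos x hx).ne'
  rcases le_or_gt C 0 with hC0 | hC0
  · apply aux_main (fun x => (1 - ∑ j, x j ^ 2) * (-C * u x ^ p) + 2 * N * u x)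
    · refine ContinuousOn.add (ContinuousOn.mul (Continuous.continuousOn (by fun_prop)) ?_) ?_
      · exact continuousOn_const.mul hupc
      · exact continuousOn_const.mul hu1'.continuousOn
    · intro x hx
      have h1 := hpos x hx
      have h2 : 0 ≤ 1 - ∑ j, x j ^ 2 := by
        rw [← EuclideanSpace.real_norm_sq_eq]
        have : ‖x‖ < 1 := by simpa using hx
        nlinarith [norm_nonneg x]
      have h3 : 0 ≤ -C * u x ^ p := mul_nonneg (by linarith) (Real.rpow_nonneg h1.le _)
      positivity
    · intro ε hε
      refine ⟨fun i x => -((1 - ∑ j, x j ^ 2) * d i x) - 2 * (u x * x i),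
        fun x => -((1 - ∑ j, x j ^ 2) * ∑ i, x i * D i x) - 2 * (u x * ∑ j, x j ^ 2),
        ?_, ?_, ?_, ?_, ?_⟩
      · intro i
        refine ContDiffOn.sub (ContDiffOn.neg (ContDiffOn.mul ?_ (hdC i)))
          (contDiffOn_const.mul (hu1'.mul (hxC i).contDiffOn))
        exact ContDiff.contDiffOn (by fun_prop)
      · refine ContinuousOn.sub (ContinuousOn.neg (ContinuousOn.mul ?_ ?_)) ?_
        · exact Continuous.continuousOn (by fun_prop)
        · exact continuousOn_finsetSum _ fun i _ => (hxc i).continuousOn.mul (hDC i)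
        · exact continuousOn_const.mul (huc.mul (Continuous.continuousOn (by fun_prop)))
      · intro x hx
        simp_rw [fun i => hDd i x hx]
        simp only [mul_sub, Finset.sum_sub_distrib]
        congr 1
        · rw [Finset.mul_sum, ← Finset.sum_neg_distrib]
          exact Finset.sum_congr rfl fun i _ => by ring
        · rw [Finset.mul_sum, Finset.mul_sum]
          exact Finset.sum_congr rfl fun i _ => by ring
      · intro x hx
        have hx1 : ‖x‖ = 1 := by simpa using hx
        beta_reduce
        rw [hsum x hx1, hzero x hx]
        simpa using hε
      · intro x hx
        have e : ∀ i, fderiv ℝ (fun x => -((1 - ∑ j, x j ^ 2) * d i x) - 2 * (u x * x i)) x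
            (EuclideanSpace.single i (1:ℝ)) = -((1 - ∑ j, x j ^ 2) * h i i x) - 2 * u x := by
          intro i
          have k1 := HasFDerivAt.fun_sum (u := Finset.univ) fun j _ => (hxx j x).pow 2
          have k2 := ((k1.const_sub 1).mul (hdx i x hx)).neg.fun_sub
            (((hux x hx).mul (hxx i x)).const_mul 2)
          have k3 := k2.fderiv
          simp only [Pi.mul_apply, Pi.neg_apply] at k3
          rw [k3]
          simp [hh, hue]
          ring
        rw [Finset.sum_congr rfl fun i _ => e i, Finset.sum_sub_distrib, Finset.sum_neg_distrib,
          ← Finset.mul_sum, hlap x hx]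
        simp
        ring
  · apply aux_main (fun x => C * u x ^ p)
    · exact continuousOn_const.mul hupc
    · intro x hx
      exact mul_pos hC0 (Real.rpow_pos_of_pos (hpos x hx) _)
    · intro ε hε
      refine ⟨fun i x => ε⁻¹ * ((∑ j, x j * d j x) * d i x - (∑ j, d j x ^ 2) / 2 * x i
          + C / q * (u x ^ q * x i) + ((N:ℝ) - 2) / 2 * (u x * d i x)) + d i x,
        fun x => ε⁻¹ * ((∑ j, x j * D j x) * (∑ j, x j * D j x)
          - (∑ j, D j x ^ 2) / 2 * (∑ j, x j ^ 2)
          + C / q * (u x ^ q * (∑ j, x j ^ 2)) + ((N:ℝ) - 2) / 2 * (u x * (∑ j, x j * D j x)))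
          + (∑ j, x j * D j x),
        ?_, ?_, ?_, ?_, ?_⟩
      · intro i
        have c1 : ContDiffOn ℝ 1 (fun x => ∑ j, x j * d j x) (ball 0 1) :=
          ContDiffOn.sum fun j _ => (hxC j).contDiffOn.mul (hdC j)
        have c2 : ContDiffOn ℝ 1 (fun x => ∑ j, d j x ^ 2) (ball 0 1) :=
          ContDiffOn.sum fun j _ => (hdC j).pow 2
        have c3 : ContDiffOn ℝ 1 (fun x => u x ^ q) (ball 0 1) :=
          hu1'.rpow_const_of_ne fun x hx => (hpos x hx).ne'
        have c4 := (hxC i).contDiffOn (s := ball 0 1)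
        exact (contDiffOn_const.mul ((((c1.mul (hdC i)).sub ((c2.div_const 2).mul c4)).add
          (contDiffOn_const.mul (c3.mul c4))).add
          (contDiffOn_const.mul (hu1'.mul (hdC i))))).add (hdC i)
      · have c1 : ContinuousOn (fun x => ∑ j, x j * D j x) (closedBall 0 1) :=
          continuousOn_finsetSum _ fun j _ => (hxc j).continuousOn.mul (hDC j)
        have c2 : ContinuousOn (fun x => ∑ j, D j x ^ 2) (closedBall 0 1) :=
          continuousOn_finsetSum _ fun j _ => (hDC j).pow 2
        have c3 : ContinuousOn (fun x => u x ^ q) (closedBall 0 1) :=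
          huc.rpow_const fun x hx => Or.inr qpos.le
        have c4 : ContinuousOn (fun x : EuclideanSpace ℝ (Fin N) => ∑ j, x j ^ 2)
          (closedBall 0 1) := Continuous.continuousOn (by fun_prop)
        exact (continuousOn_const.mul ((((c1.mul c1).sub ((c2.div_const 2).mul c4)).add
          (continuousOn_const.mul (c3.mul c4))).add
          (continuousOn_const.mul (huc.mul c1)))).add c1
      · intro x hx
        simp_rw [fun i => hDd i x hx]
        have : ∀ a b c f : ℝ, ∑ i, x i * (ε⁻¹ * (a * d i x - b * x i
          + c * (u x ^ q * x i) + f * (u x * d i x)) + d i x)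
          = ε⁻¹ * (a * (∑ i, x i * d i x) - b * (∑ i, x i ^ 2)
          + c * (u x ^ q * (∑ i, x i ^ 2)) + f * (u x * (∑ i, x i * d i x)))
            + ∑ i, x i * d i x := by
          intro a b c f
          simp only [Finset.mul_sum, ← Finset.sum_add_distrib, ← Finset.sum_sub_distrib]
          exact Finset.sum_congr rfl fun i _ => by ring
        rw [this]
      · intro x hx
        have hx1 : ‖x‖ = 1 := by simpa using hx
        have hDD : ∑ j, D j x ^ 2 = (∑ j, x j * D j x) ^ 2 := by
          have : ∀ j, D j x ^ 2 = x j ^ 2 * (∑ j, x j * D j x) ^ 2 := by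
            intro j; rw [← mul_pow, ← hDs j x hx1]
          rw [Finset.sum_congr rfl fun j _ => this j, ← Finset.sum_mul, hsum x hx1, one_mul]
        beta_reduce
        rw [hDD, hsum x hx1, hzero x hx, Real.zero_rpow qpos.ne']
        generalize ∑ j, x j * D j x = A
        have : ε⁻¹ * (A * A - A ^ 2 / 2 * 1 + C / q * (0 * 1) + ((N:ℝ) - 2) / 2 * (0 * A)) + A
          = ε⁻¹ * ((A + ε) ^ 2 / 2) - ε / 2 := by
          field_simp; ring
        rw [this]
        have : 0 ≤ ε⁻¹ * ((A + ε) ^ 2 / 2) := by positivity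
        linarith
      · intro x hx
        have hup := hpos x hx
        have hq1 : q - 1 = p := by rw [hq]; ring
        have huq : u x ^ q = u x ^ p * u x := by rw [hq, Real.rpow_add_one hup.ne']
        have e : ∀ i, fderiv ℝ (fun x => ε⁻¹ * ((∑ j, x j * d j x) * d i x
            - (∑ j, d j x ^ 2) / 2 * x i
            + C / q * (u x ^ q * x i) + ((N:ℝ) - 2) / 2 * (u x * d i x)) + d i x) x
            (EuclideanSpace.single i (1:ℝ)) =
            ε⁻¹ * ((∑ j, x j * d j x) * h i i x + d i x * (∑ j, x j * h j i x) + d i x ^ 2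
              - (∑ j, d j x ^ 2) / 2 - x i * (∑ j, d j x * h j i x)
              + C / q * (u x ^ p * u x) + C * u x ^ p * (x i * d i x)
              + ((N:ℝ) - 2) / 2 * (d i x ^ 2 + u x * h i i x)) + h i i x := by
          intro i
          have k1 := HasFDerivAt.fun_sum (u := Finset.univ)
            fun j _ => (hxx j x).fun_mul (hdx j x hx)
          have k2 := HasFDerivAt.fun_sum (u := Finset.univ) fun j _ => (hdx j x hx).pow 2
          have k3 := (hux x hx).rpow_const (p := q) (Or.inl hup.ne')
          have k4 := (((((k1.fun_mul (hdx i x hx)).fun_sub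
            ((k2.mul_const (2⁻¹)).fun_mul (hxx i x))).fun_add
            ((k3.fun_mul (hxx i x)).const_mul (C / q))).fun_add
            (((hux x hx).fun_mul (hdx i x hx)).const_mul (((N:ℝ) - 2) / 2))).const_mul ε⁻¹).fun_add
            (hdx i x hx)
          have k5 := k4.fderiv
          simp only [← div_eq_mul_inv] at k5
          rw [k5]
          simp [hh, hue, Pi.single_apply, Finset.sum_add_distrib, hq1, huq]
          have s1 : ∑ j, 2 * d j x * h j i x = 2 * ∑ j, d j x * h j i x := by
            rw [Finset.mul_sum]; exact Finset.sum_congr rfl fun j _ => by ring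
          rw [s1]
          field_simp
          ring
        rw [Finset.sum_congr rfl fun i _ => e i]
        have hcross : ∑ i, d i x * (∑ j, x j * h j i x) = ∑ i, x i * (∑ j, d j x * h j i x) := by
          simp only [Finset.mul_sum]
          rw [Finset.sum_comm]
          refine Finset.sum_congr rfl fun i _ => Finset.sum_congr rfl fun j _ => ?_
          rw [hsymm x hx i j]; ring
        have hl := hlap x hx
        simp only [Finset.sum_add_distrib, Finset.sum_sub_distrib, ← Finset.mul_sum, hcross, hl]
        simp only [Finset.sum_const, Finset.card_univ, Fintype.card_fin, nsmul_eq_mul]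
        have hNq : (N:ℝ) * (C / q) = C * (((N:ℝ) - 2) / 2) := by
          field_simp; linarith
        have hNq' : C / q * (u x ^ p * ((N:ℝ) * u x)) = C * (((N:ℝ) - 2) / 2) * (u x ^ p * u x) := by
          rw [← hNq]; ring
        rw [hNq']
        ring
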